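/- For real numbers λ ≥ σ > 0 and real s, the integral ∫_{-π}^{π} (cos²θ/σ² + sin²θ/λ²)^s dθ equals (2πσ/λ^{1+2s}) · ₂F₁(1/2, 1+s; 1; 1 - σ²/λ²). -/

import Mathlib

open Real MeasureTheory intervalIntegral

/-- Gauss hypergeometric series `₂F₁(a,b;c;z)` over the reals. -/
noncomputable def hyp2F1 (a b c z : ℝ) : ℝ :=
  ∑' n : ℕ, ((ascPochhammer ℝ n).eval a * (ascPochhammer ℝ n).eval b /
      ((ascPochhammer ℝ n).eval c * (n.factorial : ℝ))) * z ^ n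

/-- The binomial series of `(1 - x) ^ (-b)`, with Pochhammer coefficients. -/
theorem hasSum_one_sub_rpow_neg (b : ℝ) {x : ℝ} (hx : |x| < 1) :
    HasSum (fun n : ℕ ↦ (ascPochhammer ℝ n).eval b / n.factorial * x ^ n) ((1 - x) ^ (-b)) := by
  have h := (Real.one_div_one_sub_rpow_hasFPowerSeriesOnBall_zero b).hasSum
    (y := x) (by simpa [enorm_eq_nnnorm, ← NNReal.coe_lt_coe] using hx)
  have hpos : 0 ≤ 1 - x := by linarith [le_abs_self x]
  have hcoeff (n : ℕ) :
      (ascPochhammer ℝ n).eval b / n.factorial = Ring.choose (b + n - 1) n := by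
    have h2 := Ring.factorial_nsmul_multichoose_eq_ascPochhammer b n
    rw [Polynomial.ascPochhammer_smeval_eq_eval, nsmul_eq_mul] at h2
    rw [Ring.choose, ← h2, show b + n - 1 - n + 1 = b by ring]
    field_simp
  simp only [hcoeff]
  rw [rpow_neg hpos]
  simpa [mul_comm] using h

theorem integral_cos_pow_two_mul (n : ℕ) :
    ∫ θ in (-π)..π, cos θ ^ (2 * n) =
      2 * π * ((ascPochhammer ℝ n).eval (1 / 2) / n.factorial) := by
  induction n with
  | zero => simp; ring
  | succ n ih =>
    rw [show 2 * (n + 1) = 2 * n + 2 by ring, integral_cos_pow, ih, ascPochhammer_succ_eval,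
      Nat.factorial_succ]
    simp only [sin_neg, sin_pi]
    push_cast
    field_simp
    ring

theorem integral_one_sub_mul_cos_sq_rpow_neg (b : ℝ) {z : ℝ} (hz0 : 0 ≤ z) (hz1 : z < 1) :
    ∫ θ in (-π)..π, (1 - z * cos θ ^ 2) ^ (-b) = 2 * π * hyp2F1 (1 / 2) b 1 z := by
  have hzabs : |z| < 1 := by rwa [abs_of_nonneg hz0]
  have hle (θ : ℝ) : |z * cos θ ^ 2| ≤ z := by
    rw [abs_of_nonneg (by positivity)]
    exact mul_le_of_le_one_right hz0 (cos_sq_le_one θ)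
  have h : HasSum (fun n : ℕ ↦ ∫ θ in (-π)..π,
      (ascPochhammer ℝ n).eval b / n.factorial * (z * cos θ ^ 2) ^ n)
      (∫ θ in (-π)..π, (1 - z * cos θ ^ 2) ^ (-b)) := by
    refine hasSum_integral_of_dominated_convergence
      (fun n _ ↦ |(ascPochhammer ℝ n).eval b / n.factorial * z ^ n|) (fun n ↦ ?_)
      (fun n ↦ .of_forall fun θ _ ↦ ?_) (.of_forall fun θ _ ↦ ?_)
      intervalIntegrable_const (.of_forall fun θ _ ↦ ?_)
    · exact Continuous.aestronglyMeasurable (by fun_prop)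
    · rw [norm_eq_abs, abs_mul, abs_mul, abs_pow, abs_pow, abs_of_nonneg hz0]
      gcongr
      exact hle θ
    · exact (hasSum_one_sub_rpow_neg b hzabs).summable.abs
    · exact hasSum_one_sub_rpow_neg b ((hle θ).trans_lt hz1)
  rw [hyp2F1, ← tsum_mul_left, ← h.tsum_eq]
  refine tsum_congr fun n ↦ ?_
  simp only [mul_pow, ← pow_mul, ← mul_assoc]
  rw [intervalIntegral.integral_const_mul, integral_cos_pow_two_mul, ascPochhammer_eval_one]
  field_simp

/-- The angle `φ` with `tan φ = k * tan θ`, continuous in `θ`. -/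
noncomputable def scaledAngle (k θ : ℝ) : ℝ :=
  θ + arctan ((k - 1) * (sin θ * cos θ) / (cos θ ^ 2 + k * sin θ ^ 2))

theorem cos_sq_add_mul_sin_sq_pos {k : ℝ} (hk : 0 < k) (θ : ℝ) :
    0 < cos θ ^ 2 + k * sin θ ^ 2 := by
  rcases eq_or_ne (sin θ) 0 with h | h
  · have := sin_sq_add_cos_sq θ
    rw [h] at this ⊢
    linarith
  · positivity

theorem cos_sq_scaledAngle {k : ℝ} (hk : 0 < k) (θ : ℝ) :
    cos (scaledAngle k θ) ^ 2 = cos θ ^ 2 / (cos θ ^ 2 + k ^ 2 * sin θ ^ 2) := by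
  have hD := cos_sq_add_mul_sin_sq_pos hk θ
  have hE := cos_sq_add_mul_sin_sq_pos (sq_pos_of_pos hk) θ
  have hD' := hD.ne'
  set w := (k - 1) * (sin θ * cos θ) / (cos θ ^ 2 + k * sin θ ^ 2) with hw
  have hcs := sin_sq_add_cos_sq θ
  have h1 : cos θ - sin θ * w = cos θ / (cos θ ^ 2 + k * sin θ ^ 2) := by
    rw [eq_div_iff hD']
    linear_combination -sin θ * (eq_div_iff hD').mp hw + cos θ * hcs
  have h2 : 1 + w ^ 2 =
      (cos θ ^ 2 + k ^ 2 * sin θ ^ 2) / (cos θ ^ 2 + k * sin θ ^ 2) ^ 2 := by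
    rw [hw]
    field_simp
    linear_combination (cos θ ^ 2 + k ^ 2 * sin θ ^ 2) * hcs
  have h3 : cos (scaledAngle k θ) = (cos θ - sin θ * w) / √(1 + w ^ 2) := by
    rw [scaledAngle, cos_add, cos_arctan, sin_arctan]
    ring
  rw [h3, div_pow, sq_sqrt (by positivity), h1, h2]
  field_simp

theorem hasDerivAt_scaledAngle {k : ℝ} (hk : 0 < k) (θ : ℝ) :
    HasDerivAt (scaledAngle k) (k / (cos θ ^ 2 + k ^ 2 * sin θ ^ 2)) θ := by
  have hD := cos_sq_add_mul_sin_sq_pos hk θ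
  have hE := cos_sq_add_mul_sin_sq_pos (sq_pos_of_pos hk) θ
  have hcs := sin_sq_add_cos_sq θ
  have hnum := ((hasDerivAt_sin θ).mul (hasDerivAt_cos θ)).const_mul (k - 1)
  have hden := ((hasDerivAt_cos θ).pow 2).add (((hasDerivAt_sin θ).pow 2).const_mul k)
  refine ((hasDerivAt_id θ).add (hnum.div hden hD.ne').arctan).congr_deriv ?_
  have h2 : 1 + ((k - 1) * (sin θ * cos θ) / (cos θ ^ 2 + k * sin θ ^ 2)) ^ 2 =
      (cos θ ^ 2 + k ^ 2 * sin θ ^ 2) / (cos θ ^ 2 + k * sin θ ^ 2) ^ 2 := by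
    field_simp
    linear_combination (cos θ ^ 2 + k ^ 2 * sin θ ^ 2) * hcs
  simp only [Pi.mul_apply, Pi.add_apply, Pi.pow_apply, Pi.div_apply]
  rw [h2]
  have hD' := hD.ne'
  have hE' := hE.ne'
  field_simp
  push_cast
  linear_combination ((k - 1) * (cos θ ^ 2 - k * sin θ ^ 2) + k) * hcs

theorem integral_cos_sq_div_add_sin_sq_div_rpow {σ lam : ℝ} (s : ℝ) (hσ : 0 < σ) (hl : 0 < lam) :
    ∫ θ in (-π)..π, (cos θ ^ 2 / σ ^ 2 + sin θ ^ 2 / lam ^ 2) ^ s =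
      σ / lam ^ (1 + 2 * s) *
        ∫ θ in (-π)..π, (1 - (1 - σ ^ 2 / lam ^ 2) * cos θ ^ 2) ^ (-(1 + s)) := by
  have hk : 0 < lam / σ := by positivity
  have hE := cos_sq_add_mul_sin_sq_pos (sq_pos_of_pos hk)
  have hpos (θ : ℝ) : 0 < cos θ ^ 2 / σ ^ 2 + sin θ ^ 2 / lam ^ 2 := by
    have h := cos_sq_add_mul_sin_sq_pos (k := σ ^ 2 / lam ^ 2) (by positivity) θ
    have : cos θ ^ 2 / σ ^ 2 + sin θ ^ 2 / lam ^ 2 =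
        (cos θ ^ 2 + σ ^ 2 / lam ^ 2 * sin θ ^ 2) / σ ^ 2 := by field_simp
    rw [this]
    positivity
  have hsub := integral_comp_mul_deriv (a := -π) (b := π) (f := scaledAngle (lam / σ))
    (g := fun φ ↦ (cos φ ^ 2 / σ ^ 2 + sin φ ^ 2 / lam ^ 2) ^ s)
    (fun θ _ ↦ hasDerivAt_scaledAngle hk θ)
    (Continuous.continuousOn <| by
      exact continuous_const.div (by fun_prop) fun θ ↦ (hE θ).ne')
    (Continuous.rpow_const (by fun_prop) fun θ ↦ .inl (hpos θ).ne')
  have hend : scaledAngle (lam / σ) (-π) = -π ∧ scaledAngle (lam / σ) π = π := by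
    simp [scaledAngle]
  rw [hend.1, hend.2] at hsub
  rw [← hsub, ← intervalIntegral.integral_const_mul]
  refine intervalIntegral.integral_congr fun θ _ ↦ ?_
  have hcs := sin_sq_add_cos_sq θ
  have hEq : cos θ ^ 2 + (lam / σ) ^ 2 * sin θ ^ 2 =
      (lam / σ) ^ 2 * (1 - (1 - σ ^ 2 / lam ^ 2) * cos θ ^ 2) := by
    rw [sin_sq]
    field_simp
    ring
  have hX : 0 < 1 - (1 - σ ^ 2 / lam ^ 2) * cos θ ^ 2 :=
    pos_of_mul_pos_right (hEq ▸ hE θ) (by positivity)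
  have hbase : cos (scaledAngle (lam / σ) θ) ^ 2 / σ ^ 2 +
      sin (scaledAngle (lam / σ) θ) ^ 2 / lam ^ 2 =
      (lam ^ 2 * (1 - (1 - σ ^ 2 / lam ^ 2) * cos θ ^ 2))⁻¹ := by
    have hne := (hE θ).ne'
    have hX' : lam ^ 2 * (1 - (1 - σ ^ 2 / lam ^ 2) * cos θ ^ 2) =
        σ ^ 2 * (cos θ ^ 2 + (lam / σ) ^ 2 * sin θ ^ 2) := by
      rw [hEq]
      field_simp
    have hsin : sin (scaledAngle (lam / σ) θ) ^ 2 =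
        (lam / σ) ^ 2 * sin θ ^ 2 / (cos θ ^ 2 + (lam / σ) ^ 2 * sin θ ^ 2) := by
      rw [sin_sq, cos_sq_scaledAngle hk, one_sub_div hne]
      ring
    rw [hsin, cos_sq_scaledAngle hk, hX']
    generalize cos θ ^ 2 + (lam / σ) ^ 2 * sin θ ^ 2 = E at hne
    field_simp
    linear_combination hcs
  simp only [Function.comp_apply]
  rw [hbase, hEq]
  set X := 1 - (1 - σ ^ 2 / lam ^ 2) * cos θ ^ 2
  rw [inv_rpow (by positivity), mul_rpow (by positivity) hX.le, rpow_neg hX.le,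
    rpow_add hX, rpow_add hl, rpow_one, rpow_one, rpow_mul hl.le, rpow_ofNat]
  have := rpow_pos_of_pos hX s
  have := rpow_pos_of_pos (sq_pos_of_pos hl) s
  field_simp

theorem integral_theorem2 (σ lam s : ℝ) (h1 : σ ≤ lam) (h2 : 0 < σ) :
    ∫ θ in (-π)..π, (Real.cos θ ^ 2 / σ ^ 2 + Real.sin θ ^ 2 / lam ^ 2) ^ s =
      (2 * π * σ / lam ^ (1 + 2 * s)) * hyp2F1 (1/2) (1 + s) 1 (1 - σ ^ 2 / lam ^ 2) := by
  have hl : 0 < lam := h2.trans_le h1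
  have hle : σ ^ 2 / lam ^ 2 ≤ 1 := div_le_one_of_le₀ (by gcongr) (by positivity)
  have hpos : 0 < σ ^ 2 / lam ^ 2 := by positivity
  rw [integral_cos_sq_div_add_sin_sq_div_rpow s h2 hl,
    integral_one_sub_mul_cos_sq_rpow_neg _ (sub_nonneg.mpr hle) (by linarith)]
  ring
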